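/- Let B₁,…,B_t, s ∈ ℝ[x₁,…,x_n] with s(x) > 0 for all x ∈ ℝⁿ, p ∈ (ℝ[x₁,…,x_n])ᵐ, Q_u ∈ ℝ^{m×m} positive semidefinite, u₀ ∈ ℝᵐ, and u_max > 0. Let f_u(x, v) := vᵀ Q_u v − u_max² ∈ ℝ[x₁,…,x_n, v₁,…,v_m]. Suppose that the polynomial (in the variables (x, v) ∈ ℝⁿ × ℝᵐ) −vᵀ Q_u (p(x) − s(x) u₀) + s(x) u_max² belongs to the quadratic module M(−f_u, −B₁, …, −B_t). Then for every x in the safe set X_s = {x : B_j(x) ≤ 0 for all j}, the rational controller u_SOS(x) := p(x)/s(x) satisfies the quadratic input constraint (u_SOS(x) − u₀)ᵀ Q_u (u_SOS(x) − u₀) ≤ u_max², i.e., u_SOS(x) ∈ U = {u ∈ ℝᵐ : (u − u₀)ᵀ Q_u (u − u₀) ≤ u_max²}. -/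

import Mathlib

open MvPolynomial

/-- A polynomial is a sum of squares. -/
def IsSOS {σ : Type*} (p : MvPolynomial σ ℝ) : Prop :=
  ∃ (k : ℕ) (q : Fin k → MvPolynomial σ ℝ), p = ∑ i, (q i) ^ 2

/-- Membership in the quadratic module generated by the family `f`. -/
def InQuadModule {σ : Type*} {N : ℕ} (f : Fin N → MvPolynomial σ ℝ)
    (p : MvPolynomial σ ℝ) : Prop :=
  ∃ (γ₀ : MvPolynomial σ ℝ) (γ : Fin N → MvPolynomial σ ℝ),
    IsSOS γ₀ ∧ (∀ i, IsSOS (γ i)) ∧ p = γ₀ + ∑ i, γ i * f i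

theorem IsSOS.eval_nonneg {σ : Type*} {p : MvPolynomial σ ℝ} (hp : IsSOS p) (x : σ → ℝ) :
    0 ≤ eval x p := by
  obtain ⟨k, q, rfl⟩ := hp
  simp only [map_sum, map_pow]
  positivity

theorem InQuadModule.eval_nonneg {σ : Type*} {N : ℕ} {f : Fin N → MvPolynomial σ ℝ}
    {p : MvPolynomial σ ℝ} (hp : InQuadModule f p) {x : σ → ℝ} (hx : ∀ i, 0 ≤ eval x (f i)) :
    0 ≤ eval x p := by
  obtain ⟨γ₀, γ, h₀, hγ, rfl⟩ := hp
  simp only [map_add, map_sum, map_mul]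
  exact add_nonneg (h₀.eval_nonneg x)
    (Finset.sum_nonneg fun i _ => mul_nonneg ((hγ i).eval_nonneg x) (hx i))

/-- **Quadratic input constraints via SOS certificates (Lemma 3, quadratic part).**
With `f_u(x,v) = vᵀ Q_u v − u_max²`, if the polynomial (in `(x, v)`)
`−vᵀ Q_u (p(x) − s(x) u₀) + s(x) u_max²` lies in the quadratic module
`M(−f_u, −B₁, …, −B_t)` and `s > 0` everywhere, then the rational controller
`u_SOS(x) = p(x)/s(x)` satisfies
`(u_SOS(x) − u₀)ᵀ Q_u (u_SOS(x) − u₀) ≤ u_max²` on the safe set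
`X_s = {x | B_j(x) ≤ 0 ∀ j}`. -/
theorem sos_quadratic_input_constraints {n m t : ℕ}
    (B : Fin t → MvPolynomial (Fin n) ℝ)
    (s : MvPolynomial (Fin n) ℝ)
    (hs : ∀ x : Fin n → ℝ, 0 < eval x s)
    (p : Fin m → MvPolynomial (Fin n) ℝ)
    (Qu : Matrix (Fin m) (Fin m) ℝ) (hQu : Qu.PosSemidef)
    (u0 : Fin m → ℝ) (umax : ℝ) (humax : 0 < umax)
    (fu : MvPolynomial (Fin n ⊕ Fin m) ℝ)
    (hfu : fu = (∑ j, ∑ k, X (Sum.inr j) * MvPolynomial.C (Qu j k) * X (Sum.inr k))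
        - MvPolynomial.C (umax ^ 2))
    (hmem : InQuadModule
      (Fin.cons (-fu) (fun i => -(rename Sum.inl (B i))))
      (-(∑ j, ∑ k, X (Sum.inr j) * MvPolynomial.C (Qu j k) *
          (rename Sum.inl (p k) - MvPolynomial.C (u0 k) * rename Sum.inl s))
        + MvPolynomial.C (umax ^ 2) * rename Sum.inl s)) :
    ∀ x : Fin n → ℝ, (∀ i, eval x (B i) ≤ 0) →
      ∑ j, ∑ k, (eval x (p j) / eval x s - u0 j) * Qu j k *
        (eval x (p k) / eval x s - u0 k) ≤ umax ^ 2 := by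
  intro x hx
  have hsx := hs x
  have hpairing (v : Fin m → ℝ) (hv : ∑ j, ∑ k, v j * Qu j k * v k ≤ umax ^ 2) :
      ∑ j, ∑ k, v j * Qu j k * (eval x (p k) / eval x s - u0 k) ≤ umax ^ 2 := by
    have h := hmem.eval_nonneg (x := Sum.elim x v) (by
      intro i
      refine Fin.cases ?_ (fun i => ?_) i
      · simpa [hfu] using hv
      · simpa [eval_rename] using hx i)
    simp only [map_add, map_neg, map_sum, map_mul, map_sub, eval_X, eval_C, eval_rename,
      Sum.elim_comp_inl, Sum.elim_inr] at h
    have heq : ∑ j, ∑ k, v j * Qu j k * (eval x (p k) - u0 k * eval x s) =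
        (∑ j, ∑ k, v j * Qu j k * (eval x (p k) / eval x s - u0 k)) * eval x s := by
      simp only [Finset.sum_mul]
      refine Finset.sum_congr rfl fun j _ => Finset.sum_congr rfl fun k _ => ?_
      field_simp
    rw [heq] at h
    exact le_of_mul_le_mul_right (by linarith) hsx
  set w : Fin m → ℝ := fun k => eval x (p k) / eval x s - u0 k
  change ∑ j, ∑ k, w j * Qu j k * w k ≤ umax ^ 2
  change ∀ v : Fin m → ℝ, _ → ∑ j, ∑ k, v j * Qu j k * w k ≤ umax ^ 2 at hpairing
  set S := ∑ j, ∑ k, w j * Qu j k * w k with hS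
  by_contra! hlt
  have hSpos : 0 < S := (by positivity : 0 < umax ^ 2).trans hlt
  have hsq : √S ^ 2 = S := Real.sq_sqrt hSpos.le
  have hroot : 0 < √S := Real.sqrt_pos.2 hSpos
  have hscale (c : ℝ) : ∑ j, ∑ k, c * w j * Qu j k * w k = c * S := by
    simp only [hS, Finset.mul_sum, mul_assoc]
  have hscale_sq (c : ℝ) : ∑ j, ∑ k, c * w j * Qu j k * (c * w k) = c ^ 2 * S := by
    simp only [hS, Finset.mul_sum]
    exact Finset.sum_congr rfl fun j _ => Finset.sum_congr rfl fun k _ => by ring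
  have h := hpairing (fun k => umax / √S * w k) (by
    rw [hscale_sq, div_pow, hsq, div_mul_cancel₀ _ hSpos.ne'])
  rw [hscale] at h
  have heq : umax / √S * S = umax * √S := by
    rw [div_mul_eq_mul_div, div_eq_iff hroot.ne', mul_assoc, ← sq, hsq]
  rw [heq, sq] at h
  have hle : √S ≤ umax := le_of_mul_le_mul_left h humax
  have := pow_le_pow_left₀ hroot.le hle 2
  linarith
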